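/- Let L ≥ 2 be an even integer. Then the sum, over all spin configurations s : Fin L → Bool having exactly L/2 entries equal to true, of the complex exponentials exp((2πi/L)·∑_{j=1}^{L} j·val(s_j)) equals 0. (This is the lemma ∑_α ⟨α|Û_twist|α⟩ = 0, summing the diagonal entries of the twist operator over the S^z = 0 basis.) -/

import Mathlib

open Complex

/-- Spin value of a boolean: `1/2` for up (`true`), `-1/2` for down (`false`). -/
noncomputable def sval (b : Bool) : ℝ := if b then 1/2 else -1/2

/-- A configuration with `k` up spins has total spin `k - L / 2`. -/
lemma sum_sval_eq {L : ℕ} (s : Fin L → Bool) :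
    ∑ j, ((sval (s j) : ℝ) : ℂ) =
      ((Finset.univ.filter (fun j : Fin L => s j = true)).card : ℂ) - L / 2 := by
  have h (b : Bool) : ((sval b : ℝ) : ℂ) = (if b = true then 1 else 0) - 1 / 2 := by
    cases b <;> norm_num [sval]
  simp only [h, Finset.sum_sub_distrib, Finset.sum_boole, Finset.sum_const, Finset.card_univ,
    Fintype.card_fin, nsmul_eq_mul]
  ring

/-- Effect of a cyclic translation on the dipole moment. -/
lemma sum_mul_comp_finRotate {n : ℕ} (v : Fin (n + 1) → ℂ) :
    ∑ j : Fin (n + 1), ((j.val : ℂ) + 1) * v (finRotate (n + 1) j) =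
      ∑ j : Fin (n + 1), ((j.val : ℂ) + 1) * v j - ∑ j, v j + ((n + 1 : ℕ) : ℂ) * v 0 := by
  rw [Fin.sum_univ_castSucc, Fin.sum_univ_succ (fun j => ((j.val : ℂ) + 1) * v j),
    Fin.sum_univ_succ v]
  have h : ∑ j : Fin n, (((j.succ : Fin (n + 1)).val : ℂ) + 1) * v j.succ =
      ∑ j : Fin n, ((j.val : ℂ) + 1) * v j.succ + ∑ j : Fin n, v j.succ := by
    rw [← Finset.sum_add_distrib]
    refine Finset.sum_congr rfl fun j _ => ?_
    push_cast [Fin.val_succ]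
    ring
  rw [h]
  simp only [finRotate_apply, Fin.coeSucc_eq_succ, Fin.last_add_one, Fin.val_castSucc,
    Fin.val_last, Fin.val_zero]
  push_cast
  ring

lemma exp_two_pi_I_mul_sval (b : Bool) :
    Complex.exp (2 * Real.pi * Complex.I * ((sval b : ℝ) : ℂ)) = -1 := by
  cases b
  · rw [show 2 * Real.pi * Complex.I * ((sval false : ℝ) : ℂ) = -(Real.pi * Complex.I) by
      norm_num [sval]; ring, Complex.exp_neg, Complex.exp_pi_mul_I]
    norm_num
  · rw [show 2 * Real.pi * Complex.I * ((sval true : ℝ) : ℂ) = Real.pi * Complex.I by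
      norm_num [sval]; ring, Complex.exp_pi_mul_I]

/-- The sum of the diagonal twist-operator entries
`exp((2πi/L) ∑_{j=1}^L j · val(s_j))` over all spin configurations in the
`S^z = 0` sector (exactly `L/2` up spins) vanishes, for even `L ≥ 2`. -/
theorem twist_diagonal_sum_eq_zero (L : ℕ) (hL : 2 ≤ L) (hLeven : Even L) :
    ∑ s ∈ Finset.univ.filter
        (fun s : Fin L → Bool =>
          (Finset.univ.filter (fun j : Fin L => s j = true)).card = L / 2),
      Complex.exp ((2 * Real.pi * Complex.I / L) *
        ∑ j : Fin L, ((j.val : ℂ) + 1) * ((sval (s j) : ℝ) : ℂ)) = 0 := by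
  obtain ⟨n, rfl⟩ : ∃ n, L = n + 1 := ⟨L - 1, by omega⟩
  refine self_eq_neg.mp ?_
  rw [← Finset.sum_neg_distrib]
  refine Finset.sum_equiv ((finRotate (n + 1)).arrowCongr (Equiv.refl Bool)).symm ?_ ?_
  · intro s
    simp only [Finset.mem_filter, Finset.mem_univ, true_and]
    rw [show (Finset.univ.filter fun j => s j = true).card =
      (Finset.univ.filter fun j => s (finRotate (n + 1) j) = true).card from
        (Finset.card_equiv (finRotate (n + 1)) (by simp)).symm]
    rfl
  · intro s hs
    have hcard := (Finset.mem_filter.mp hs).2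
    have hzero : ∑ j, ((sval (s j) : ℝ) : ℂ) = 0 := by
      rw [sum_sval_eq, hcard, Nat.cast_div hLeven.two_dvd two_ne_zero]
      simp
    change _ = -Complex.exp ((2 * Real.pi * Complex.I / (n + 1 : ℕ)) *
      ∑ j : Fin (n + 1), ((j.val : ℂ) + 1) * ((sval (s (finRotate (n + 1) j)) : ℝ) : ℂ))
    have hn : ((n + 1 : ℕ) : ℂ) ≠ 0 := Nat.cast_ne_zero.mpr n.succ_ne_zero
    rw [sum_mul_comp_finRotate fun j => ((sval (s j) : ℝ) : ℂ), hzero, sub_zero, mul_add,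
      ← mul_assoc _ ((n + 1 : ℕ) : ℂ), div_mul_cancel₀ _ hn, Complex.exp_add,
      exp_two_pi_I_mul_sval]
    ring
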